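/- If e and f are idempotents in a finite-dimensional power-commutative real division algebra A with ef ≠ fe, then (e − f)² is a nonzero scalar multiple of a nonzero idempotent, and (e − f)² is not contained in the linear span of {e, f}. -/

import Mathlib

open Module

section Defs

variable {A : Type*} [AddCommGroup A] [Module ℝ A]

/-- A linear subspace closed under the multiplication `m`. -/
def IsSubalg (m : A →ₗ[ℝ] A →ₗ[ℝ] A) (U : Submodule ℝ A) : Prop :=
  ∀ x ∈ U, ∀ y ∈ U, m x y ∈ U

/-- The subalgebra generated by a set `s`: the smallest subspace containing `s`
and closed under multiplication. -/
def genSubalg (m : A →ₗ[ℝ] A →ₗ[ℝ] A) (s : Set A) : Submodule ℝ A :=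
  sInf {U : Submodule ℝ A | IsSubalg m U ∧ s ⊆ (U : Set A)}

/-- `m` is a division-algebra multiplication: for nonzero `a`, both left and
right multiplication by `a` are bijective. -/
def IsDivision (m : A →ₗ[ℝ] A →ₗ[ℝ] A) : Prop :=
  ∀ a : A, a ≠ 0 →
    Function.Bijective (fun x : A => m a x) ∧ Function.Bijective (fun x : A => m x a)

/-- Power-commutativity: every subalgebra generated by a single element is commutative. -/
def PowerComm (m : A →ₗ[ℝ] A →ₗ[ℝ] A) : Prop :=
  ∀ x : A, ∀ a ∈ genSubalg m {x}, ∀ b ∈ genSubalg m {x}, m a b = m b a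

/-- An omnipresent idempotent: a nonzero idempotent contained in every
two-dimensional subalgebra. -/
def Omnipresent (m : A →ₗ[ℝ] A →ₗ[ℝ] A) (e : A) : Prop :=
  e ≠ 0 ∧ m e e = e ∧
    ∀ U : Submodule ℝ A, IsSubalg m U → Module.finrank ℝ U = 2 → e ∈ U

/-- `one` is an identity element for `m` and for every `x` the elements
`one, x, x²` are linearly dependent. -/
def IsQuadraticWith (m : A →ₗ[ℝ] A →ₗ[ℝ] A) (one : A) : Prop :=
  (∀ x : A, m one x = x ∧ m x one = x) ∧
    ∀ x : A, ¬ LinearIndependent ℝ ![one, x, m x x]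

/-- A quadratic algebra: unital, and `1, x, x²` linearly dependent for all `x`. -/
def IsQuadratic (m : A →ₗ[ℝ] A →ₗ[ℝ] A) : Prop :=
  ∃ one : A, IsQuadraticWith m one

/-- The isotope multiplication `x ∘ y = (T x)·(T y)`. -/
def isotope (m : A →ₗ[ℝ] A →ₗ[ℝ] A) (T : A →ₗ[ℝ] A) : A →ₗ[ℝ] A →ₗ[ℝ] A :=
  (m.compl₂ T).comp T

/-- A planar map on a quadratic division algebra with identity `one`:
invertible, fixes `one`, and leaves every subalgebra invariant. -/
def Planar (m : A →ₗ[ℝ] A →ₗ[ℝ] A) (one : A) (T : A →ₗ[ℝ] A) : Prop :=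
  Function.Bijective T ∧ T one = one ∧
    ∀ U : Submodule ℝ A, IsSubalg m U → ∀ x ∈ U, T x ∈ U

/-- The imaginary space `Im B = {x ∉ ℝ·1 : x² ∈ ℝ·1} ∪ {0}` of a quadratic algebra. -/
def ImSet (m : A →ₗ[ℝ] A →ₗ[ℝ] A) (one : A) : Set A :=
  {x : A | x ∉ Submodule.span ℝ {one} ∧ m x x ∈ Submodule.span ℝ {one}} ∪ {0}

/-- The centraliser `C(e) = {y : e·y = y·e}`, a linear subspace. -/
def centraliser (m : A →ₗ[ℝ] A →ₗ[ℝ] A) (e : A) : Submodule ℝ A :=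
  LinearMap.ker (m e - m.flip e)

/-- An exceptional idempotent of a four-dimensional algebra: its centraliser is
three-dimensional and closed under squaring. -/
def Exceptional (m : A →ₗ[ℝ] A →ₗ[ℝ] A) (e : A) : Prop :=
  Module.finrank ℝ (centraliser m e) = 3 ∧
    ∀ x ∈ centraliser m e, m x x ∈ centraliser m e

end Defs

theorem exists_cone_avoiding_zero {E : Type*} [AddCommGroup E] [Module ℝ E]
    (hdim : 3 ≤ finrank ℝ E) (u v w : E) :
    ∃ z : E, ∀ a b c r : ℝ, a + b = r → a • u + b • v + c • w + (1 - r) • z = 0 →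
      r = 1 ∧ a • u + b • v + c • w = 0 := by
  by_cases htop : Submodule.span ℝ (Set.range ![u, v, w]) = ⊤
  · have hli : LinearIndependent ℝ ![u, v, w] :=
      linearIndependent_of_top_le_span_of_card_le_finrank htop.ge (by simpa using hdim)
    refine ⟨(1 / 2 : ℝ) • u + (1 / 2 : ℝ) • v, fun a b c r hr h => ?_⟩
    have h' := Fintype.linearIndependent_iff.1 hli
      ![a + (1 - r) / 2, b + (1 - r) / 2, c] (by
        rw [← h]
        simp only [Fin.sum_univ_three, Matrix.cons_val]
        module)
    have h0 := h' 0
    have h1 := h' 1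
    simp only [Matrix.cons_val] at h0 h1
    linarith
  · obtain ⟨z, -, hz⟩ := SetLike.exists_of_lt (lt_top_iff_ne_top.2 htop)
    refine ⟨z, fun a b c r _ h => ?_⟩
    have hr : r = 1 := by
      by_contra hne
      have hne' : 1 - r ≠ 0 := sub_ne_zero.2 (Ne.symm hne)
      apply hz
      rw [← Submodule.smul_mem_iff _ hne', ← neg_mem_iff,
        ← eq_neg_of_add_eq_zero_left h]
      refine add_mem (add_mem ?_ ?_) ?_ <;>
        refine Submodule.smul_mem _ _ (Submodule.subset_span ?_)
      · exact ⟨0, rfl⟩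
      · exact ⟨1, rfl⟩
      · exact ⟨2, rfl⟩
    subst hr
    exact ⟨rfl, by simpa using h⟩

section CommutativeDivision

variable {E : Type*} [NormedAddCommGroup E] [NormedSpace ℝ E] [FiniteDimensional ℝ E]

/-- If squaring vanishes only at zero, then it is a proper map. -/
theorem isProperMap_square (m : E →L[ℝ] E →L[ℝ] E) (hsq : ∀ x, m x x = 0 → x = 0) :
    IsProperMap fun x => m x x := by
  have hcont : Continuous fun x => m x x := by fun_prop
  refine isProperMap_iff_tendsto_cocompact.2 ⟨hcont, ?_⟩
  rcases subsingleton_or_nontrivial E with hE | hE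
  · rw [Filter.cocompact_eq_bot]
    exact Filter.tendsto_bot
  obtain ⟨v, hv, hmin⟩ := (isCompact_sphere (0 : E) 1).exists_isMinOn
    (NormedSpace.sphere_nonempty.2 zero_le_one) hcont.norm.continuousOn
  have hv1 : ‖v‖ = 1 := by simpa using hv
  have hpos : 0 < ‖m v v‖ := by
    refine norm_pos_iff.2 fun h => ?_
    simp [hsq v h] at hv1
  have hbound : ∀ x, ‖m v v‖ * ‖x‖ ^ 2 ≤ ‖m x x‖ := by
    intro x
    rcases eq_or_ne x 0 with rfl | hx
    · simp
    have hx' : 0 < ‖x‖ := norm_pos_iff.2 hx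
    have hmem : ‖x‖⁻¹ • x ∈ Metric.sphere (0 : E) 1 := by
      simp [norm_smul, hx'.ne']
    have h := isMinOn_iff.1 hmin _ hmem
    have heq : ‖m (‖x‖⁻¹ • x) (‖x‖⁻¹ • x)‖ = ‖m x x‖ / ‖x‖ ^ 2 := by
      simp only [map_smul, smul_apply, norm_smul, norm_inv, norm_norm]
      field_simp
    rw [heq] at h
    exact (le_div_iff₀ (by positivity)).1 h
  rw [← Metric.cobounded_eq_cocompact, ← tendsto_norm_atTop_iff_cobounded]
  refine Filter.tendsto_atTop_mono hbound ?_
  exact ((Filter.tendsto_pow_atTop two_ne_zero).comp tendsto_norm_cobounded_atTop).const_mul_atTop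
    hpos

/-- In a commutative real division algebra, squaring is a covering map away from zero. -/
theorem isCoveringMapOn_square (m : E →L[ℝ] E →L[ℝ] E) (hcomm : ∀ x y, m x y = m y x)
    (hdiv : ∀ x y, m x y = 0 → x = 0 ∨ y = 0) :
    IsCoveringMapOn (fun x => m x x) {0}ᶜ := by
  have hsq : ∀ x, m x x = 0 → x = 0 := fun x hx => (hdiv x x hx).elim id id
  refine (isProperMap_square m hsq).isClosedMap.isCoveringMapOn_of_isLocalHomeomorphOn ?_ ?_
  · intro y _
    rcases ((fun x => m x x) ⁻¹' {y}).eq_empty_or_nonempty with h | ⟨x, hx⟩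
    · simp [h]
    · refine (Set.toFinite {x, -x}).subset fun z hz => ?_
      have hzx : m (z - x) (z + x) = 0 := by
        have h : m z z = m x x := by
          rw [Set.mem_preimage, Set.mem_singleton_iff] at hx hz
          rw [hz, hx]
        simp [h, hcomm z x, add_comm]
      rcases hdiv _ _ hzx with h | h
      · exact Or.inl (sub_eq_zero.1 h)
      · exact Or.inr (eq_neg_of_add_eq_zero_left h)
  · intro x hx
    have hx0 : x ≠ 0 := by
      rintro rfl
      simp at hx
    have hinj : Function.Injective ((2 : ℝ) • m x : E →ₗ[ℝ] E) := by
      refine (injective_iff_map_eq_zero _).2 fun y hy => ?_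
      have hy' : m x y = 0 := by simpa using hy
      exact (hdiv x y hy').resolve_left hx0
    let L : E ≃L[ℝ] E := (LinearEquiv.ofInjectiveEndo _ hinj).toContinuousLinearEquiv
    have hderiv : HasStrictFDerivAt (fun x => m x x) (L : E →L[ℝ] E) x := by
      have h := (m.hasStrictFDerivAt (x := x)).clm_apply (hasStrictFDerivAt_id x)
      have hL : (L : E →L[ℝ] E) = (m x).comp (.id ℝ E) + m.flip x := by
        ext y
        have hLy : L y = (2 : ℝ) • m x y := rfl
        simp [hLy, hcomm y x, two_smul]
      rw [hL]
      exact h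
    exact ⟨hderiv.toOpenPartialHomeomorph _, hderiv.mem_toOpenPartialHomeomorph_source, rfl⟩

/-- Hopf's theorem, for an algebra carrying a norm. -/
theorem finrank_le_two_of_comm_of_noZeroDivisors (m : E →L[ℝ] E →L[ℝ] E)
    (hcomm : ∀ x y, m x y = m y x) (hdiv : ∀ x y, m x y = 0 → x = 0 ∨ y = 0) :
    finrank ℝ E ≤ 2 := by
  by_contra! hdim
  have cov := isCoveringMapOn_square m hcomm hdiv
  obtain ⟨x, hx⟩ : ∃ x : E, x ≠ 0 :=
    have := Module.nontrivial_of_finrank_pos (R := ℝ) (M := E) (by omega)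
    exists_ne 0
  obtain ⟨y, hxy⟩ := exists_linearIndependent_pair_of_one_lt_finrank (R := ℝ) (by omega) hx
  have hsquare : ∀ a b : ℝ,
      m (a • x + b • y) (a • x + b • y) =
        a ^ 2 • m x x + b ^ 2 • m y y + (2 * a * b) • m x y := by
    intro a b
    simp only [map_add, map_smul, add_apply, smul_apply,
      hcomm y x]
    module
  have hnonzero : ∀ a b : ℝ, a ^ 2 + b ^ 2 = 1 → a • x + b • y ≠ 0 := by
    intro a b hab h
    obtain ⟨rfl, rfl⟩ := LinearIndependent.pair_iff.1 hxy a b h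
    norm_num at hab
  obtain ⟨z, hz⟩ := exists_cone_avoiding_zero hdim (m x x) (m y y) (m x y)
  let G : C(ℂ, E) := ⟨fun w => ((‖w‖ + w.re) / 2) • m x x + ((‖w‖ - w.re) / 2) • m y y +
    w.im • m x y + (1 - ‖w‖) • z, by fun_prop⟩
  let path : C(ℝ, E) := ⟨fun t => Real.cos t • x + Real.sin t • y, by fun_prop⟩
  let circle : C(ℝ, ℂ) :=
    ⟨fun t => Complex.equivRealProdCLM.symm (Real.cos (2 * t), Real.sin (2 * t)), by fun_prop⟩
  have hcircle_re : ∀ t, (circle t).re = Real.cos (2 * t) := fun t => rfl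
  have hcircle_im : ∀ t, (circle t).im = Real.sin (2 * t) := fun t => rfl
  have hG_circle : ∀ t, G (circle t) = m (path t) (path t) := by
    intro t
    have hnorm : ‖circle t‖ = 1 := by
      rw [← sq_eq_sq₀ (norm_nonneg _) zero_le_one, Complex.sq_norm, Complex.normSq_apply,
        hcircle_re, hcircle_im]
      linarith [Real.sin_sq_add_cos_sq (2 * t)]
    simp only [G, path, ContinuousMap.coe_mk, hsquare, hnorm]
    simp only [hcircle_re, hcircle_im, Real.cos_two_mul, Real.sin_two_mul, Real.sin_sq]
    module
  have hG_ne : ∀ w, G w ∈ ({0}ᶜ : Set E) := by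
    intro w hw
    obtain ⟨hw1, hw2⟩ := hz _ _ _ _ (by ring) hw
    obtain ⟨t, ht⟩ : ∃ t, circle t = w := by
      refine ⟨w.arg / 2, Complex.ext ?_ ?_⟩
      · rw [hcircle_re, mul_div_cancel₀ _ two_ne_zero]
        simpa [hw1] using Complex.norm_mul_cos_arg w
      · rw [hcircle_im, mul_div_cancel₀ _ two_ne_zero]
        simpa [hw1] using Complex.norm_mul_sin_arg w
    have hpath : path t = 0 := by
      refine (hdiv _ _ ?_).elim id id
      rw [← hG_circle, ht]
      exact hw
    exact hnonzero _ _ (Real.cos_sq_add_sin_sq t) hpath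
  obtain ⟨g, ⟨hg0, hg⟩, -⟩ := cov.existsUnique_continuousMap_lifts G
    (hG_circle 0).symm hG_ne
  have hunique := cov.existsUnique_continuousMap_lifts (G.comp circle) (a₀ := 0) (e₀ := path 0)
    (hG_circle 0).symm fun t => hG_ne _
  have heq : g.comp circle = path := by
    refine hunique.unique ⟨hg0, ?_⟩ ⟨rfl, ?_⟩
    · ext t
      exact congrFun hg (circle t)
    · ext t
      exact (hG_circle t).symm
  have hloop : path 0 = path Real.pi := by
    rw [← heq]
    simp [circle]
  have hx2 : x = -x := by simpa [path] using hloop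
  have hx3 : (2 : ℝ) • x = 0 := by
    rw [two_smul]
    exact eq_neg_iff_add_eq_zero.1 hx2
  exact hx (by simpa using hx3)

end CommutativeDivision

/-- **Hopf's theorem**: a commutative real division algebra has dimension at most two. -/
theorem finrank_le_two_of_comm_division {D : Type*} [AddCommGroup D] [Module ℝ D]
    [FiniteDimensional ℝ D] (m : D →ₗ[ℝ] D →ₗ[ℝ] D) (hcomm : ∀ x y, m x y = m y x)
    (hdiv : ∀ x y, m x y = 0 → x = 0 ∨ y = 0) : finrank ℝ D ≤ 2 := by
  let φ : D ≃ₗ[ℝ] (Fin (finrank ℝ D) → ℝ) := (finBasis ℝ D).equivFun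
  let ψ := φ.symm.toLinearMap
  let μ : (Fin (finrank ℝ D) → ℝ) →ₗ[ℝ] (Fin (finrank ℝ D) → ℝ) →ₗ[ℝ]
      (Fin (finrank ℝ D) → ℝ) := (m.compl₁₂ ψ ψ).compr₂ φ.toLinearMap
  have h := finrank_le_two_of_comm_of_noZeroDivisors
    (LinearMap.toContinuousLinearMap
      ((LinearMap.toContinuousLinearMap : _ ≃ₗ[ℝ] _).toLinearMap ∘ₗ μ))
    (fun x y => by simp [μ, hcomm (ψ x)])
    (fun x y hxy => by
      have : m (φ.symm x) (φ.symm y) = 0 := by simpa [μ, ψ] using hxy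
      simpa using hdiv _ _ this)
  simpa using h

section PowerCommutative

variable {A : Type*} [AddCommGroup A] [Module ℝ A] {m : A →ₗ[ℝ] A →ₗ[ℝ] A}

theorem IsDivision.eq_zero_or_eq_zero (hdiv : IsDivision m) {x y : A} (h : m x y = 0) :
    x = 0 ∨ y = 0 := by
  by_contra! hxy
  exact hxy.2 ((hdiv x hxy.1).1.injective (by simpa using h))

theorem subset_genSubalg (s : Set A) : s ⊆ genSubalg m s := fun x hx => by
  simp only [genSubalg, SetLike.mem_coe, Submodule.mem_sInf]
  exact fun U hU => hU.2 hx

theorem isSubalg_genSubalg (s : Set A) : IsSubalg m (genSubalg m s) := by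
  intro x hx y hy
  simp only [genSubalg, Submodule.mem_sInf] at hx hy ⊢
  exact fun U hU => hU.1 x (hx U hU) y (hy U hU)

theorem finrank_genSubalg_singleton_le_two [FiniteDimensional ℝ A] (hdiv : IsDivision m)
    (hpc : PowerComm m) (x : A) : finrank ℝ (genSubalg m {x}) ≤ 2 := by
  refine finrank_le_two_of_comm_division
    (LinearMap.mk₂ ℝ
      (fun a b : genSubalg m {x} => ⟨m a b, isSubalg_genSubalg {x} a a.2 b b.2⟩)
      (fun a b c => by ext; simp) (fun r a b => by ext; simp)
      (fun a b c => by ext; simp) (fun r a b => by ext; simp))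
    (fun a b => Subtype.ext (hpc x a a.2 b b.2)) (fun a b hab => ?_)
  have h := hdiv.eq_zero_or_eq_zero (congrArg Subtype.val hab)
  simpa using h

/-- A one-generated subalgebra is spanned by any two of its linearly independent elements. -/
theorem exists_combination_of_mem_genSubalg [FiniteDimensional ℝ A] (hdiv : IsDivision m)
    (hpc : PowerComm m) {x u v w : A} (hu : u ∈ genSubalg m {x}) (hv : v ∈ genSubalg m {x})
    (hw : w ∈ genSubalg m {x}) (huv : LinearIndependent ℝ ![u, v]) :
    ∃ a b : ℝ, a • u + b • v = w := by
  have hle : Submodule.span ℝ (Set.range ![u, v]) ≤ genSubalg m {x} := by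
    rw [Submodule.span_le, Matrix.range_cons_cons_empty]
    rintro _ (rfl | rfl)
    exacts [hu, hv]
  have heq := Submodule.eq_of_le_of_finrank_le hle (by
    rw [finrank_span_eq_card huv]
    simpa using finrank_genSubalg_singleton_le_two hdiv hpc x)
  rw [← heq, Matrix.range_cons_cons_empty] at hw
  exact Submodule.mem_span_pair.1 hw

theorem PowerComm.commute_square (hpc : PowerComm m) (x : A) : m x (m x x) = m (m x x) x := by
  have hx : x ∈ genSubalg m {x} := subset_genSubalg {x} rfl
  exact hpc x x hx _ (isSubalg_genSubalg {x} x hx x hx)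

/-- The square of a difference of idempotents commutes with both idempotents. -/
theorem PowerComm.commute_sub_square (hpc : PowerComm m) {e f : A} (he : m e e = e)
    (hf : m f f = f) : m e (m (e - f) (e - f)) = m (m (e - f) (e - f)) e := by
  have h1 := hpc.commute_square (e + f)
  have h2 := hpc.commute_square (e - f)
  simp only [map_add, map_sub, LinearMap.add_apply, LinearMap.sub_apply, he, hf] at h1 h2 ⊢
  linear_combination (norm := module) (1 / 2 : ℝ) • h2 - (1 / 2 : ℝ) • h1

end PowerCommutative

/-- If `e`, `f` are idempotents in a finite-dimensional power-commutative
real division algebra with `ef ≠ fe`, then `(e − f)²` is a nonzero scalar multiple of a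
nonzero idempotent and is not contained in span{e, f}. -/
theorem stmt_4 {A : Type*} [AddCommGroup A] [Module ℝ A] [FiniteDimensional ℝ A]
    (m : A →ₗ[ℝ] A →ₗ[ℝ] A) (hdiv : IsDivision m) (hpc : PowerComm m)
    (e f : A) (he : m e e = e) (hf : m f f = f) (hne : m e f ≠ m f e) :
    (∃ (c : ℝ) (g : A), c ≠ 0 ∧ g ≠ 0 ∧ m g g = g ∧ m (e - f) (e - f) = c • g) ∧
    m (e - f) (e - f) ∉ Submodule.span ℝ {e, f} := by
  set h := m (e - f) (e - f) with hh
  have hcomm_e : m e h = m h e := hpc.commute_sub_square he hf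
  have hef : LinearIndependent ℝ ![e, f] := by
    refine LinearIndependent.pair_iff.2 fun a b hab => ?_
    have h1 : m e (a • e + b • f) = m (a • e + b • f) e := by simp [hab]
    have h2 : m f (a • e + b • f) = m (a • e + b • f) f := by simp [hab]
    simp only [map_add, map_smul, LinearMap.add_apply, LinearMap.smul_apply, add_right_inj,
      add_left_inj] at h1 h2
    constructor
    · by_contra ha
      exact hne (smul_right_injective A ha h2).symm
    · by_contra hb
      exact hne (smul_right_injective A hb h1)
  have hxne : e - f ≠ 0 := fun h0 => hne (by rw [sub_eq_zero.1 h0])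
  have hh0 : h ≠ 0 := fun h0 => hxne ((hdiv.eq_zero_or_eq_zero h0).elim id id)
  have hnot : h ∉ Submodule.span ℝ {e, f} := by
    intro hmem
    obtain ⟨a, b, hab⟩ := Submodule.mem_span_pair.1 hmem
    have hcomm_f : m f h = m h f := by
      have hswap : m (f - e) (f - e) = h := by
        rw [← neg_sub e f, map_neg, map_neg, LinearMap.neg_apply, neg_neg]
      exact hswap ▸ hpc.commute_sub_square hf he
    rw [← hab] at hcomm_e hcomm_f
    simp only [map_add, map_smul, LinearMap.add_apply, LinearMap.smul_apply, add_right_inj,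
      add_left_inj] at hcomm_e hcomm_f
    have ha : a = 0 := by
      by_contra ha
      exact hne (smul_right_injective A ha hcomm_f).symm
    have hb : b = 0 := by
      by_contra hb
      exact hne (smul_right_injective A hb hcomm_e)
    exact hh0 (by rw [← hab, ha, hb]; simp)
  refine ⟨?_, hnot⟩
  have hindep : ∀ a b c : ℝ, a • e + b • f + c • h = 0 → a = 0 ∧ b = 0 ∧ c = 0 := by
    intro a b c habc
    have hc : c = 0 := by
      by_contra hc
      refine hnot (Submodule.mem_span_pair.2 ⟨-a / c, -b / c, ?_⟩)
      apply smul_right_injective A hc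
      simp only [smul_add, smul_smul, mul_div_cancel₀ _ hc]
      linear_combination (norm := module) -habc
    subst hc
    obtain ⟨ha, hb⟩ := LinearIndependent.pair_iff.1 hef a b (by simpa using habc)
    exact ⟨ha, hb, rfl⟩
  have hsub : ∃ a b : ℝ, a • (e - f) + b • h = m h h := by
    have hx : e - f ∈ genSubalg m {e - f} := subset_genSubalg _ rfl
    have hhx : h ∈ genSubalg m {e - f} := isSubalg_genSubalg _ _ hx _ hx
    refine exists_combination_of_mem_genSubalg hdiv hpc hx hhx
      (isSubalg_genSubalg _ _ hhx _ hhx) (LinearIndependent.pair_iff.2 fun s t hst => ?_)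
    obtain ⟨hs, -, ht⟩ := hindep s (-s) t (by rw [← hst]; module)
    exact ⟨hs, ht⟩
  have hadd : ∃ a b : ℝ, a • (e + f) + b • h = m h h := by
    have hx : e + f ∈ genSubalg m {e + f} := subset_genSubalg _ rfl
    have hhx : h ∈ genSubalg m {e + f} := by
      have h_eq : h = (2 : ℝ) • (e + f) - m (e + f) (e + f) := by
        simp only [hh, map_add, map_sub, LinearMap.add_apply, LinearMap.sub_apply, he, hf]
        module
      rw [h_eq]
      exact sub_mem (Submodule.smul_mem _ _ hx) (isSubalg_genSubalg _ _ hx _ hx)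
    refine exists_combination_of_mem_genSubalg hdiv hpc hx hhx
      (isSubalg_genSubalg _ _ hhx _ hhx) (LinearIndependent.pair_iff.2 fun s t hst => ?_)
    obtain ⟨hs, -, ht⟩ := hindep s s t (by rw [← hst]; module)
    exact ⟨hs, ht⟩
  obtain ⟨a, b, hab⟩ := hsub
  obtain ⟨c, d, hcd⟩ := hadd
  obtain ⟨h1, h2, -⟩ := hindep (a - c) (-a - c) (b - d) (by
    rw [← sub_eq_zero.2 (hab.trans hcd.symm)]
    module)
  have ha : a = 0 := by linarith
  have hhh : m h h = b • h := by rw [← hab, ha]; simp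
  have hb : b ≠ 0 := by
    rintro rfl
    exact hh0 ((hdiv.eq_zero_or_eq_zero (by simpa using hhh)).elim id id)
  refine ⟨b, b⁻¹ • h, hb, smul_ne_zero (inv_ne_zero hb) hh0, ?_, ?_⟩
  · simp [hhh, smul_smul, hb]
  · rw [smul_smul, mul_inv_cancel₀ hb, one_smul]
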